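/- Let V be a finite-dimensional real vector space, g a positive-definite symmetric bilinear form on V, y ∈ V with y ≠ 0, and h(X,Z) := g(X,Z) − g(X,y)g(Z,y)/g(y,y) the angular metric. Let C be a symmetric trilinear form on V which is C3-like, i.e., there are linear functionals a, b, c on V with C(X,Y,Z) = h(X,Y)a(Z) + h(Y,Z)a(X) + h(Z,X)a(Y) + c(X)c(Y)b(Z) + c(Y)c(Z)b(X) + c(Z)c(X)b(Y) for all X,Y,Z ∈ V. Suppose moreover that a = λ·c for some real number λ ≠ 0. If a vector B ∈ V, linearly independent from y, satisfies the SC-condition C(B,X,Y) = 0 for all X,Y ∈ V, and c(B) = 0, then c = 0 and hence C = 0. -/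

import Mathlib

/-- Strict Cauchy-Schwarz: the angular metric at `y` is positive on vectors independent of `y`. -/
lemma angular_metric_self_pos {V : Type*} [AddCommGroup V] [Module ℝ V]
    (g : V →ₗ[ℝ] V →ₗ[ℝ] ℝ) (hgsymm : ∀ X Z : V, g X Z = g Z X)
    (hgpos : ∀ X : V, X ≠ 0 → 0 < g X X) {B y : V}
    (hBy : LinearIndependent ℝ ![B, y]) :
    0 < g B B - g B y * g B y / g y y := by
  have hyy : g y y ≠ 0 := (hgpos y (hBy.ne_zero 1)).ne'
  have hne : B - (g B y / g y y) • y ≠ 0 := fun h0 => by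
    have := LinearIndependent.pair_iff.mp hBy 1 (-(g B y / g y y))
      (by rw [one_smul, neg_smul, ← sub_eq_add_neg, h0])
    exact one_ne_zero this.1
  have hpos := hgpos _ hne
  simp only [map_sub, map_smul, LinearMap.sub_apply, LinearMap.smul_apply, smul_eq_mul,
    hgsymm y B] at hpos
  convert hpos using 1
  field_simp
  ring

/-- Pointwise model of Theorem 3.2: a C3-like symmetric trilinear form `C` with
`a = λ·c`, `λ ≠ 0`, admitting a semi-concurrent vector `B` linearly independent
from `y` with `c(B) = 0`, vanishes. -/
theorem C3_like_SC_J_zero_implies_riemannian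
    (V : Type*) [AddCommGroup V] [Module ℝ V] [FiniteDimensional ℝ V]
    (g : V →ₗ[ℝ] V →ₗ[ℝ] ℝ)
    (hgsymm : ∀ X Z : V, g X Z = g Z X)
    (hgpos : ∀ X : V, X ≠ 0 → 0 < g X X)
    (y : V) (hy : y ≠ 0)
    (h : V → V → ℝ)
    (hdef : ∀ X Z : V, h X Z = g X Z - g X y * g Z y / g y y)
    (C : V →ₗ[ℝ] V →ₗ[ℝ] V →ₗ[ℝ] ℝ)
    (a b c : V →ₗ[ℝ] ℝ)
    (hC3 : ∀ X Y Z : V, C X Y Z =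
      h X Y * a Z + h Y Z * a X + h Z X * a Y +
      c X * c Y * b Z + c Y * c Z * b X + c Z * c X * b Y)
    (lam : ℝ) (hlam : lam ≠ 0) (ha : a = lam • c)
    (B : V) (hBy : LinearIndependent ℝ ![B, y])
    (hSC : ∀ X Y : V, C B X Y = 0)
    (hcB : c B = 0) :
    c = 0 ∧ C = 0 := by
  have hpos : 0 < h B B := by
    rw [hdef]
    exact angular_metric_self_pos g hgsymm hgpos hBy
  have hc : c = 0 := by
    ext Y
    have hBBY := hSC B Y
    simp only [hC3, ha, LinearMap.smul_apply, smul_eq_mul, hcB, mul_zero, zero_mul,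
      add_zero] at hBBY
    simpa [hpos.ne', hlam] using hBBY
  refine ⟨hc, ?_⟩
  ext X Y Z
  simp [hC3, ha, hc]
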